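/- Let q = 2^n with n even and n ≥ 4. For every a ∈ F_{q^4}^*, the map x ↦ x^{2q^3+2q^2+2q+3} + a·x is NOT a bijection of F_{q^4}. -/

import Mathlib

open Polynomial

/-- The polynomial `Y ^ 9 + a Y ^ 7 + b Y ^ 5 + c Y ^ 3 + d Y`, as a function. -/
def oddNonic {k : Type*} [Field k] (a b c d : k) (y : k) : k :=
  y ^ 9 + a * y ^ 7 + b * y ^ 5 + c * y ^ 3 + d * y

/-- The polynomial `1 + a Z + b Z ^ 2 + c Z ^ 3 + d Z ^ 4`. -/
noncomputable def revQuartic {k : Type*} [Field k] (a b c d : k) : k[X] :=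
  1 + C a * X + C b * X ^ 2 + C c * X ^ 3 + C d * X ^ 4

section Hermite

variable {k : Type*} [Field k]

lemma natDegree_revQuartic_le (a b c d : k) : (revQuartic a b c d).natDegree ≤ 4 := by
  unfold revQuartic
  compute_degree

lemma revQuartic_mul (a b c d : k) (p : k[X]) :
    revQuartic a b c d * p =
      p + C a * (X ^ 1 * p) + C b * (X ^ 2 * p) + C c * (X ^ 3 * p) + C d * (X ^ 4 * p) := by
  unfold revQuartic
  ring

lemma coeff_zero_revQuartic_pow (a b c d : k) (m : ℕ) :
    (revQuartic a b c d ^ m).coeff 0 = 1 := by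
  simp [coeff_zero_eq_eval_zero, revQuartic]

lemma oddNonic_pow (a b c d : k) {m : ℕ} (hm : 0 < m) (y : k) :
    oddNonic a b c d y ^ m =
      ∑ i ∈ Finset.range (4 * m + 1),
        (revQuartic a b c d ^ m).coeff i * y ^ (9 * m - 2 * i) := by
  obtain rfl | hy := eq_or_ne y 0
  · rw [Finset.sum_eq_zero]
    · simp [oddNonic, hm.ne']
    · intro i hi
      rw [Finset.mem_range] at hi
      rw [zero_pow (by omega), mul_zero]
  · have h1 : oddNonic a b c d y = y ^ 9 * (revQuartic a b c d).eval ((y ^ 2)⁻¹) := by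
      simp only [oddNonic, revQuartic, eval_add, eval_mul, eval_pow, eval_C, eval_X, eval_one]
      field_simp
    have hdeg : (revQuartic a b c d ^ m).natDegree < 4 * m + 1 :=
      Nat.lt_succ_of_le ((natDegree_pow_le_of_le m (natDegree_revQuartic_le a b c d)).trans
        (by rw [mul_comm]))
    rw [h1, mul_pow, ← eval_pow, eval_eq_sum_range' hdeg, Finset.mul_sum]
    refine Finset.sum_congr rfl fun i hi => ?_
    rw [Finset.mem_range] at hi
    have h2 : y ^ (9 * m) = y ^ (9 * m - 2 * i) * y ^ (2 * i) := by
      rw [← pow_add]; congr 1; omega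
    rw [← pow_mul, h2, inv_pow, ← pow_mul]
    field_simp

lemma sum_pow_eq_ite [Fintype k] {e : ℕ} (he : 0 < e) :
    ∑ x : k, x ^ e = if Fintype.card k - 1 ∣ e then -1 else 0 := by
  classical
  rw [← FiniteField.sum_pow_units k e, ← Finset.sum_erase_add _ _ (Finset.mem_univ (0 : k)),
    zero_pow he.ne', add_zero]
  symm
  refine Finset.sum_bij (fun u _ => (u : k)) (by simp) (fun u _ v _ h => Units.ext h) ?_ (by simp)
  intro x hx
  exact ⟨Units.mk0 x (Finset.ne_of_mem_erase hx), by simp, rfl⟩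

/-- Hermite's criterion for `oddNonic`. -/
lemma sum_coeff_revQuartic_pow_eq_zero [Fintype k] {a b c d : k}
    (hinj : Function.Injective (oddNonic a b c d)) {m : ℕ} (hm : 0 < m)
    (hmq : m < Fintype.card k - 1) :
    ∑ i ∈ Finset.range (4 * m + 1) with Fintype.card k - 1 ∣ 9 * m - 2 * i,
      (revQuartic a b c d ^ m).coeff i = 0 := by
  have h1 : ∑ y : k, oddNonic a b c d y ^ m = 0 := by
    rw [(Finite.injective_iff_bijective.mp hinj).sum_comp (fun x => x ^ m)]
    exact FiniteField.sum_pow_lt_card_sub_one k m hmq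
  simp_rw [oddNonic_pow a b c d hm] at h1
  rw [Finset.sum_comm] at h1
  simp_rw [← Finset.mul_sum] at h1
  rw [Finset.sum_filter, ← neg_eq_zero, ← Finset.sum_neg_distrib]
  refine (Finset.sum_congr rfl fun i hi => ?_).trans h1
  rw [Finset.mem_range] at hi
  rw [sum_pow_eq_ite (by omega)]
  split_ifs <;> simp

variable [CharP k 2]

lemma coeff_pow_four (p : k[X]) (n : ℕ) :
    (p ^ 4).coeff n = if 4 ∣ n then p.coeff (n / 4) ^ 4 else 0 := by
  have := map_iterateFrobenius_expand 2 p 2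
  norm_num at this
  rw [← this, coeff_map, coeff_expand (by norm_num)]
  split_ifs <;> simp [iterateFrobenius_def]

lemma coeff_revQuartic_mul_pow_four (a b c d : k) (p : k[X]) (l : ℕ) :
    (revQuartic a b c d * p ^ 4).coeff (4 * l + 3) = c * p.coeff l ^ 4 := by
  rw [revQuartic_mul]
  have h0 (n : ℕ) (hn : ¬ 4 ∣ n) : (p ^ 4).coeff n = 0 := by rw [coeff_pow_four, if_neg hn]
  have h3 : (p ^ 4).coeff (4 * l) = p.coeff l ^ 4 := by
    rw [coeff_pow_four, if_pos (dvd_mul_right 4 l), Nat.mul_div_cancel_left l (by norm_num)]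
  have h4 : (X ^ 4 * p ^ 4).coeff (4 * l + 3) = 0 := by
    rw [coeff_X_pow_mul']
    split_ifs
    · exact h0 _ (by omega)
    · rfl
  simp only [coeff_add, coeff_C_mul, h4, coeff_X_pow_mul]
  rw [h0 _ (by omega), h0 _ (by omega), h0 _ (by omega), h3]
  ring

lemma coeff_three_revQuartic_pow (a b c d : k) (j : ℕ) :
    (revQuartic a b c d ^ (1 + 4 * j)).coeff 3 = c := by
  rw [pow_add, pow_one, mul_comm 4, pow_mul]
  simpa [coeff_zero_revQuartic_pow] using
    coeff_revQuartic_mul_pow_four a b c d (revQuartic a b c d ^ j) 0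

lemma coeff_fifteen_revQuartic_pow (a b c d : k) (j : ℕ) :
    (revQuartic a b c d ^ (5 + 16 * j)).coeff 15 = c ^ 5 := by
  rw [show 5 + 16 * j = 1 + (1 + 4 * j) * 4 by ring, pow_add, pow_one, pow_mul]
  rw [coeff_revQuartic_mul_pow_four a b c d (revQuartic a b c d ^ (1 + 4 * j)) 3,
    coeff_three_revQuartic_pow]
  ring

/-- A finite field of order at least `64` and of order a power of `4` has no permutation polynomial
of the form `Y ^ 9 + a Y ^ 7 + b Y ^ 5 + c Y ^ 3 + d Y`. -/
lemma not_injective_oddNonic [Fintype k] {s : ℕ} (hs : 3 ≤ s) (hk : Fintype.card k = 4 ^ s)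
    (a b c d : k) : ¬ Function.Injective (oddNonic a b c d) := by
  intro hinj
  obtain ⟨t, rfl⟩ : ∃ t, s = 3 + t := ⟨s - 3, by omega⟩
  have hge : 1 ≤ 4 ^ t := Nat.one_le_pow _ _ (by norm_num)
  have hc : c ≠ 0 := by
    rintro rfl
    obtain ⟨j, hj⟩ : ∃ j, 4 ^ t = 3 * j + 1 := by
      have : 4 ^ t % 3 = 1 := by simp [Nat.pow_mod]
      exact ⟨4 ^ t / 3, by omega⟩
    have hq : Fintype.card k = 64 * (3 * j + 1) := by rw [hk, pow_add, hj]; norm_num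
    have h := sum_coeff_revQuartic_pow_eq_zero hinj (m := 64 * j + 21) (by omega) (by omega)
    have hset : {i ∈ Finset.range (4 * (64 * j + 21) + 1) |
        Fintype.card k - 1 ∣ 9 * (64 * j + 21) - 2 * i} = {0, 4 * (48 * j + 15) + 3} := by
      ext i
      simp only [Finset.mem_filter, Finset.mem_range, Finset.mem_insert, Finset.mem_singleton, hq]
      constructor
      · rintro ⟨hi, e, he⟩
        have he4 : e < 4 := by
          by_contra hcon
          have := Nat.mul_le_mul_left (64 * (3 * j + 1) - 1) (not_lt.mp hcon)
          omega
        interval_cases e <;> omega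
      · rintro (rfl | rfl)
        · exact ⟨by omega, 3, by omega⟩
        · exact ⟨by omega, 1, by omega⟩
    rw [hset, Finset.sum_pair (by omega), coeff_zero_revQuartic_pow,
      show 64 * j + 21 = 1 + (16 * j + 5) * 4 by ring, pow_add, pow_one, pow_mul,
      coeff_revQuartic_mul_pow_four] at h
    simp at h
  have hsingle : ∀ m i₀ : ℕ, m < Fintype.card k - 1 → 0 < m → i₀ ≤ 4 * m →
      9 * m - 2 * i₀ = Fintype.card k - 1 → 9 * m < 2 * (Fintype.card k - 1) →
      (revQuartic a b c d ^ m).coeff i₀ = 0 := by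
    intro m i₀ h1 h2 h3 h4 h5
    have h := sum_coeff_revQuartic_pow_eq_zero hinj h2 h1
    have hset : {i ∈ Finset.range (4 * m + 1) |
        Fintype.card k - 1 ∣ 9 * m - 2 * i} = {i₀} := by
      ext i
      simp only [Finset.mem_filter, Finset.mem_range, Finset.mem_singleton]
      constructor
      · rintro ⟨hi, e, he⟩
        have he2 : e < 2 := by
          by_contra hcon
          have := Nat.mul_le_mul_left (Fintype.card k - 1) (not_lt.mp hcon)
          omega
        interval_cases e <;> omega
      · rintro rfl
        exact ⟨by omega, 1, by omega⟩
    rwa [hset, Finset.sum_singleton] at h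
  have hmod : 4 ^ (3 + t) % 9 = 1 ∧ 1 ≤ t ∨ 4 ^ (3 + t) % 9 = 1 ∧ t = 0 ∨
      4 ^ (3 + t) % 9 = 4 ∧ 1 ≤ t ∨ 4 ^ (3 + t) % 9 = 7 ∧ 1 ≤ t := by
    have h64 : ∀ u, 64 ^ u % 9 = 1 := fun u => by simp [Nat.pow_mod]
    have hdm := Nat.div_add_mod t 3
    have hlt := Nat.mod_lt t (show 3 > 0 by norm_num)
    have hpow : 4 ^ (3 + t) = 64 * (64 ^ (t / 3) * 4 ^ (t % 3)) := by
      conv_lhs => rw [← hdm]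
      rw [pow_add, pow_add, pow_mul]; norm_num
    have h := h64 (t / 3)
    rw [hpow]
    generalize t % 3 = u at *
    interval_cases u <;> omega
  have hq : Fintype.card k = 64 * 4 ^ t := by rw [hk, pow_add]; norm_num
  have h4t : 1 ≤ t → 4 ∣ 4 ^ t := fun h => dvd_pow_self 4 (by omega)
  rw [← hk] at hmod
  have h1 : Fintype.card k % 9 ≠ 1 := by
    intro h1
    have h := hsingle ((Fintype.card k - 1) / 9) 0 (by omega) (by omega) (by omega) (by omega)
      (by omega)
    rw [coeff_zero_revQuartic_pow] at h
    exact one_ne_zero h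
  rcases hmod with hmod | hmod | ⟨hmod, ht⟩ | ⟨hmod, ht⟩
  · exact h1 hmod.1
  · exact h1 hmod.1
  · have h := hsingle ((Fintype.card k + 5) / 9) 3 (by omega) (by omega) (by omega) (by omega)
      (by omega)
    rw [show (Fintype.card k + 5) / 9 = 1 + 4 * ((Fintype.card k + 5) / 9 / 4) by omega,
      coeff_three_revQuartic_pow] at h
    exact hc h
  · have h := hsingle ((Fintype.card k + 29) / 9) 15 (by omega) (by omega) (by omega) (by omega)
      (by omega)
    rw [show (Fintype.card k + 29) / 9 = 5 + 16 * ((Fintype.card k + 29) / 9 / 16) by omega,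
      coeff_fifteen_revQuartic_pow] at h
    exact hc (pow_eq_zero_iff (by norm_num) |>.mp h)

/-- The relations between the coefficients of an `oddNonic` permuting a field of order `16`
which come from the exponents `3` and `5` in Hermite's criterion. -/
lemma coeff_relations_of_card_eq_sixteen [Fintype k] (hk : Fintype.card k = 16) {a b c d : k}
    (hinj : Function.Injective (oddNonic a b c d)) :
    c ^ 2 + b ^ 3 + a ^ 2 * d = 0 ∧ c ^ 5 = 1 := by
  have h2 : (2 : k) = 0 := CharTwo.two_eq_zero
  constructor
  · have h := sum_coeff_revQuartic_pow_eq_zero hinj (m := 3) (by omega) (by omega)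
    rw [hk, show {i ∈ Finset.range (4 * 3 + 1) | 16 - 1 ∣ 9 * 3 - 2 * i} = {6} by decide,
      Finset.sum_singleton] at h
    rw [pow_succ', revQuartic_mul] at h
    have hsq (n : ℕ) : (revQuartic a b c d ^ 2).coeff n =
        if 2 ∣ n then (revQuartic a b c d).coeff (n / 2) ^ 2 else 0 := by
      rw [← map_frobenius_expand 2, coeff_map, coeff_expand (by norm_num)]
      split_ifs <;> simp [frobenius_def]
    simp only [coeff_add, coeff_C_mul, coeff_X_pow_mul', hsq] at h
    norm_num [revQuartic, coeff_X, coeff_one, coeff_X_pow, coeff_C] at h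
    linear_combination h
  · have h := sum_coeff_revQuartic_pow_eq_zero hinj (m := 5) (by omega) (by omega)
    rw [hk, show {i ∈ Finset.range (4 * 5 + 1) | 16 - 1 ∣ 9 * 5 - 2 * i} = {0, 15} by decide,
      Finset.sum_pair (by norm_num), coeff_zero_revQuartic_pow,
      coeff_fifteen_revQuartic_pow a b c d 0] at h
    linear_combination h - h2

end Hermite

/-- Coordinates of an element of the field of order `16` with respect to the powers of a root of
`X ^ 4 + X + 1`. -/
abbrev Bits := Bool × Bool × Bool × Bool

namespace Bits

/-- Addition in coordinates. -/
def add : Bits → Bits → Bits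
  | (x0, x1, x2, x3), (y0, y1, y2, y3) => (x0 ^^ y0, x1 ^^ y1, x2 ^^ y2, x3 ^^ y3)

/-- Multiplication in coordinates. -/
def mul : Bits → Bits → Bits
  | (x0, x1, x2, x3), (y0, y1, y2, y3) =>
    let z4 := (x1 && y3) ^^ (x2 && y2) ^^ (x3 && y1)
    let z5 := (x2 && y3) ^^ (x3 && y2)
    let z6 := x3 && y3
    ((x0 && y0) ^^ z4, (x0 && y1) ^^ (x1 && y0) ^^ z4 ^^ z5,
      (x0 && y2) ^^ (x1 && y1) ^^ (x2 && y0) ^^ z5 ^^ z6,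
      (x0 && y3) ^^ (x1 && y2) ^^ (x2 && y1) ^^ (x3 && y0) ^^ z6)

/-- The coordinates of `1`. -/
def one : Bits := (true, false, false, false)

/-- The value of `X ^ 4 + a X ^ 3 + b X ^ 2 + X + d` at `x`. -/
def quartic (a b d x : Bits) : Bits :=
  add (mul (add (mul (add (mul (add x a) x) b) x) one) x) d

lemma exists_mul_eq_one : ∀ x : Bits, x = (false, false, false, false) ∨ ∃ y, mul x y = one := by
  decide +kernel

set_option synthInstance.maxSize 2000 in
/-- For `b ^ 3 + a ^ 2 d = 1`, either `Y ↦ Y (Y ^ 8 + a Y ^ 6 + b Y ^ 4 + Y ^ 2 + d)` is not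
injective or `X ^ 4 + a X ^ 3 + b X ^ 2 + X + d` is a product of two quadratic polynomials. -/
lemma collision_or_factorization : ∀ a b d : Bits,
    add (mul b (mul b b)) (mul (mul a a) d) = one →
      (∃ x y, x ≠ y ∧ mul x (quartic a b d (mul x x)) = mul y (quartic a b d (mul y y))) ∨
      ∃ p r, add (mul p (add (add b r) (mul p (add a p)))) (mul r (add a p)) = one ∧
        mul r (add (add b r) (mul p (add a p))) = d := by
  decide +kernel

end Bits

section CardSixteen

variable {k : Type*} [Field k]

lemma exists_pow_four_eq_add_one [Fintype k] [CharP k 2] (hk : Fintype.card k = 16) :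
    ∃ α : k, α ^ 4 = α + 1 := by
  by_contra! hα
  have h2 : (2 : k) = 0 := CharTwo.two_eq_zero
  have hdeg :
      (X ^ 12 + X ^ 9 + X ^ 8 + X ^ 6 + X ^ 4 + X ^ 3 + X ^ 2 + X : k[X]).natDegree = 12 := by
    compute_degree!
  have hzero : (X ^ 12 + X ^ 9 + X ^ 8 + X ^ 6 + X ^ 4 + X ^ 3 + X ^ 2 + X : k[X]) = 0 := by
    refine eq_zero_of_natDegree_lt_card_of_eval_eq_zero _ (f := fun x : k => x)
      Function.injective_id (fun x => ?_) (by rw [hdeg, hk]; norm_num)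
    have hx : x ^ 16 = x := hk ▸ FiniteField.pow_card x
    have hne : x ^ 4 + x + 1 ≠ 0 := fun h => hα x (by linear_combination h - (x + 1) * h2)
    refine (mul_eq_zero.mp ?_).resolve_left hne
    simp only [eval_add, eval_pow, eval_X]
    linear_combination hx + (x ^ 13 + x ^ 12 + x ^ 10 + x ^ 9 + x ^ 8 + x ^ 7 + x ^ 6 + x ^ 5
      + x ^ 4 + x ^ 3 + x ^ 2 + x) * h2
  rw [hzero] at hdeg
  simp at hdeg

namespace Bits

/-- The field element with the given coordinates in powers of `α`. -/
def toField (α : k) : Bits → k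
  | (x0, x1, x2, x3) => cond x0 1 0 + cond x1 1 0 * α + cond x2 1 0 * α ^ 2 + cond x3 1 0 * α ^ 3

lemma toField_one (α : k) : toField α one = 1 := by simp [toField, one]

lemma cond_and (x y : Bool) : (cond (x && y) 1 0 : k) = cond x 1 0 * cond y 1 0 := by
  cases x <;> cases y <;> simp

lemma cond_xor [CharP k 2] (x y : Bool) :
    (cond (x ^^ y) 1 0 : k) = cond x 1 0 + cond y 1 0 := by
  cases x <;> cases y <;> simp [CharTwo.add_self_eq_zero]

lemma toField_mul [CharP k 2] {α : k} (hα : α ^ 4 = α + 1) (x y : Bits) :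
    toField α (mul x y) = toField α x * toField α y := by
  obtain ⟨x0, x1, x2, x3⟩ := x
  obtain ⟨y0, y1, y2, y3⟩ := y
  simp only [toField, mul, cond_xor, cond_and]
  generalize (cond x0 1 0 : k) = x0
  generalize (cond x1 1 0 : k) = x1
  generalize (cond x2 1 0 : k) = x2
  generalize (cond x3 1 0 : k) = x3
  linear_combination (-((x1 * cond y3 1 0 + x2 * cond y2 1 0 + x3 * cond y1 1 0)
    + (x2 * cond y3 1 0 + x3 * cond y2 1 0) * α + x3 * cond y3 1 0 * α ^ 2)) * hα

lemma toField_add [CharP k 2] (α : k) (x y : Bits) :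
    toField α (add x y) = toField α x + toField α y := by
  obtain ⟨x0, x1, x2, x3⟩ := x
  obtain ⟨y0, y1, y2, y3⟩ := y
  simp only [toField, add, cond_xor]
  ring

lemma toField_bijective [Fintype k] [CharP k 2] (hk : Fintype.card k = 16) {α : k}
    (hα : α ^ 4 = α + 1) : Function.Bijective (toField α) := by
  refine (Fintype.bijective_iff_injective_and_card _).mpr ⟨fun x y hxy => ?_, by rw [hk]; rfl⟩
  have hsum : toField α (add x y) = 0 := by rw [toField_add, hxy, CharTwo.add_self_eq_zero]
  have hxy0 : add x y = (false, false, false, false) := by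
    refine (exists_mul_eq_one (add x y)).resolve_right ?_
    rintro ⟨z, hz⟩
    have := toField_mul hα (add x y) z
    rw [hz, toField_one, hsum, zero_mul] at this
    exact one_ne_zero this
  obtain ⟨x0, x1, x2, x3⟩ := x
  obtain ⟨y0, y1, y2, y3⟩ := y
  simpa [add] using hxy0

end Bits

open Bits in
/-- If `Y ^ 9 + a Y ^ 7 + b Y ^ 5 + c Y ^ 3 + d Y` permutes a field of order `16`, then
`c ≠ 0` and `X ^ 4 + a X ^ 3 + b X ^ 2 + c X + d` is a product of two quadratic polynomials. -/
lemma exists_factorization_of_card_eq_sixteen [Fintype k] [CharP k 2] (hk : Fintype.card k = 16)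
    {a b c d : k} (hinj : Function.Injective (oddNonic a b c d)) :
    c ≠ 0 ∧ ∃ p r s t : k, a = p + s ∧ b = r + t + p * s ∧ c = p * t + r * s ∧ d = r * t := by
  have h2 : (2 : k) = 0 := CharTwo.two_eq_zero
  obtain ⟨hrel, hc5⟩ := coeff_relations_of_card_eq_sixteen hk hinj
  have hc : c ≠ 0 := by rintro rfl; norm_num at hc5
  refine ⟨hc, ?_⟩
  obtain ⟨α, hα⟩ := exists_pow_four_eq_add_one hk
  have hbij := toField_bijective hk hα
  obtain ⟨A, hA⟩ := hbij.2 (a * c ^ 3)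
  obtain ⟨B, hB⟩ := hbij.2 (b * c)
  obtain ⟨D, hD⟩ := hbij.2 (d * c ^ 2)
  have hAB : add (mul B (mul B B)) (mul (mul A A) D) = one := by
    apply hbij.1
    simp only [toField_add, toField_mul hα, toField_one, hA, hB, hD]
    linear_combination c ^ 3 * hrel + (c ^ 3 * a ^ 2 * d + 1) * hc5 - c ^ 5 * h2
  obtain ⟨x, y, hxy, h⟩ | ⟨P, R, h1, h3⟩ := collision_or_factorization A B D hAB
  · have hscale (z : Bits) : oddNonic a b c d (c * toField α z) =
        c ^ 9 * toField α (mul z (quartic A B D (mul z z))) := by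
      simp only [quartic, toField_add, toField_mul hα, toField_one, hA, hB, hD, oddNonic]
      generalize toField α z = z
      linear_combination (-(a * z ^ 7 * c ^ 7 + b * z ^ 5 * c ^ 5
        + d * z * (c ^ 6 + c)) - c ^ 4 * z ^ 3) * hc5
    refine absurd (hbij.1 (mul_left_cancel₀ hc (hinj ?_))) hxy
    rw [hscale, hscale, h]
  · have h1' := congrArg (toField α) h1
    have h3' := congrArg (toField α) h3
    simp only [toField_add, toField_mul hα, toField_one, hA, hB, hD] at h1' h3'
    generalize toField α P = p at h1' h3'
    generalize toField α R = r at h1' h3'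
    refine ⟨p * c ^ 2, r * c ^ 4, (a * c ^ 3 + p) * c ^ 2,
      (b * c + r + p * (a * c ^ 3 + p)) * c ^ 4, ?_, ?_, ?_, ?_⟩
    · linear_combination -a * hc5 - p * c ^ 2 * h2
    · linear_combination -b * hc5 - (r * c ^ 4 + p * (a * c ^ 3 + p) * c ^ 4) * h2
    · linear_combination -c ^ 6 * h1' - c * hc5
    · linear_combination -c ^ 8 * h3' - d * (c ^ 5 + 1) * hc5

end CardSixteen

section Norm

variable {k K : Type*} [Field k] [Field K] [Algebra k K] [Finite K]

lemma mem_range_algebraMap_of_pow_card_eq {x : K} (hx : x ^ Nat.card k = x) :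
    x ∈ Set.range (algebraMap k K) := by
  have := Finite.of_injective _ (algebraMap k K).injective
  obtain ⟨p, hp⟩ := CharP.exists k
  have : Fact p.Prime := ⟨CharP.char_is_prime k p⟩
  let := ZMod.algebra k p
  refine (IsGalois.mem_range_algebraMap_iff_fixed x).mpr fun g => ?_
  obtain ⟨i, hi⟩ := FiniteField.exists_forall_apply_eq_pow k p K g
  rw [hi]
  clear hi
  induction i with
  | zero => simp
  | succ i ih => rw [pow_succ, pow_mul, ih, hx]

lemma algebraMap_norm_of_finrank_eq_four (hfin : Module.finrank k K = 4) (x : K) :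
    algebraMap k K (Algebra.norm k x) = x * x ^ Nat.card k * x ^ Nat.card k ^ 2 *
      x ^ Nat.card k ^ 3 := by
  rw [FiniteField.algebraMap_norm_eq_prod_pow, hfin]
  simp [Finset.prod_range_succ]

variable [CharP k 2]

/-- The elementary symmetric functions of the conjugates of an element of a quartic extension. -/
lemma exists_algebraMap_eq_esymm {n : ℕ} (hk : Nat.card k = 2 ^ n)
    (hfin : Module.finrank k K = 4) (r : K) : ∃ a b c d : k,
      let r₁ := r ^ Nat.card k
      let r₂ := r ^ Nat.card k ^ 2
      let r₃ := r ^ Nat.card k ^ 3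
      algebraMap k K a = r + r₁ + r₂ + r₃ ∧
      algebraMap k K b = r * r₁ + r * r₂ + r * r₃ + r₁ * r₂ + r₁ * r₃ + r₂ * r₃ ∧
      algebraMap k K c = r * r₁ * r₂ + r * r₁ * r₃ + r * r₂ * r₃ + r₁ * r₂ * r₃ ∧
      algebraMap k K d = r * r₁ * r₂ * r₃ := by
  have : CharP K 2 := charP_of_injective_algebraMap (algebraMap k K).injective 2
  have hadd (x y : K) : (x + y) ^ Nat.card k = x ^ Nat.card k + y ^ Nat.card k := by
    rw [hk, add_pow_char_pow]
  have h1 : (r ^ Nat.card k) ^ Nat.card k = r ^ Nat.card k ^ 2 := by rw [← pow_mul]; ring_nf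
  have h2 : (r ^ Nat.card k ^ 2) ^ Nat.card k = r ^ Nat.card k ^ 3 := by rw [← pow_mul]; ring_nf
  have h3 : (r ^ Nat.card k ^ 3) ^ Nat.card k = r := by
    have := Fintype.ofFinite K
    have hcard : Fintype.card K = Nat.card k ^ 4 := by
      rw [Fintype.card_eq_nat_card, Module.natCard_eq_pow_finrank (K := k), hfin]
    rw [← pow_mul, ← pow_succ, ← hcard, FiniteField.pow_card]
  obtain ⟨a, ha⟩ := mem_range_algebraMap_of_pow_card_eq (k := k)
    (x := r + r ^ Nat.card k + r ^ Nat.card k ^ 2 + r ^ Nat.card k ^ 3)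
    (by simp only [hadd, h1, h2, h3]; ring)
  obtain ⟨b, hb⟩ := mem_range_algebraMap_of_pow_card_eq (k := k)
    (x := r * r ^ Nat.card k + r * r ^ Nat.card k ^ 2 + r * r ^ Nat.card k ^ 3 +
      r ^ Nat.card k * r ^ Nat.card k ^ 2 + r ^ Nat.card k * r ^ Nat.card k ^ 3 +
      r ^ Nat.card k ^ 2 * r ^ Nat.card k ^ 3)
    (by simp only [hadd, mul_pow, h1, h2, h3]; ring)
  obtain ⟨c, hc⟩ := mem_range_algebraMap_of_pow_card_eq (k := k)
    (x := r * r ^ Nat.card k * r ^ Nat.card k ^ 2 + r * r ^ Nat.card k * r ^ Nat.card k ^ 3 +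
      r * r ^ Nat.card k ^ 2 * r ^ Nat.card k ^ 3 +
      r ^ Nat.card k * r ^ Nat.card k ^ 2 * r ^ Nat.card k ^ 3)
    (by simp only [hadd, mul_pow, h1, h2, h3]; ring)
  obtain ⟨d, hd⟩ := mem_range_algebraMap_of_pow_card_eq (k := k)
    (x := r * r ^ Nat.card k * r ^ Nat.card k ^ 2 * r ^ Nat.card k ^ 3)
    (by simp only [mul_pow, h1, h2, h3]; ring)
  exact ⟨a, b, c, d, ha, hb, hc, hd⟩

lemma norm_mul_sq_add {n : ℕ} (hk : Nat.card k = 2 ^ n) (hfin : Module.finrank k K = 4) {r : K}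
    {a b c d : k}
    (ha : algebraMap k K a = r + r ^ Nat.card k + r ^ Nat.card k ^ 2 + r ^ Nat.card k ^ 3)
    (hb : algebraMap k K b = r * r ^ Nat.card k + r * r ^ Nat.card k ^ 2 + r * r ^ Nat.card k ^ 3 +
      r ^ Nat.card k * r ^ Nat.card k ^ 2 + r ^ Nat.card k * r ^ Nat.card k ^ 3 +
      r ^ Nat.card k ^ 2 * r ^ Nat.card k ^ 3)
    (hc : algebraMap k K c = r * r ^ Nat.card k * r ^ Nat.card k ^ 2 +
      r * r ^ Nat.card k * r ^ Nat.card k ^ 3 + r * r ^ Nat.card k ^ 2 * r ^ Nat.card k ^ 3 +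
      r ^ Nat.card k * r ^ Nat.card k ^ 2 * r ^ Nat.card k ^ 3)
    (hd : algebraMap k K d = r * r ^ Nat.card k * r ^ Nat.card k ^ 2 * r ^ Nat.card k ^ 3)
    (x : K) :
    Algebra.norm k (x * (algebraMap k K (Algebra.norm k x) ^ 2 + r)) =
      oddNonic a b c d (Algebra.norm k x) := by
  have := Finite.of_injective _ (algebraMap k K).injective
  have : CharP K 2 := charP_of_injective_algebraMap (algebraMap k K).injective 2
  have := Fintype.ofFinite k
  rw [map_mul]
  generalize Algebra.norm k x = t
  have ht (i : ℕ) : (algebraMap k K t ^ 2) ^ Nat.card k ^ i = algebraMap k K t ^ 2 := by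
    rw [← map_pow, ← map_pow, ← Fintype.card_eq_nat_card, FiniteField.pow_card_pow]
  have ht1 := ht 1
  rw [pow_one] at ht1
  have hadd (i : ℕ) (x y : K) :
      (x + y) ^ Nat.card k ^ i = x ^ Nat.card k ^ i + y ^ Nat.card k ^ i := by
    rw [hk, ← pow_mul, add_pow_char_pow]
  have hadd1 := hadd 1
  rw [pow_one] at hadd1
  apply (algebraMap k K).injective
  rw [map_mul, algebraMap_norm_of_finrank_eq_four hfin]
  simp only [hadd, hadd1, ht, ht1, oddNonic, map_add, map_mul, map_pow, ha, hb, hc, hd]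
  ring

/-- A root of a quadratic polynomial over `k` is fixed by the square of the Frobenius. -/
lemma pow_card_sq_eq_of_quadratic {n : ℕ} (hk : Nat.card k = 2 ^ n) {r : K}
    {p s : k} (h : r ^ 2 + algebraMap k K p * r + algebraMap k K s = 0) :
    r ^ Nat.card k ^ 2 = r := by
  have := Finite.of_injective _ (algebraMap k K).injective
  have : CharP K 2 := charP_of_injective_algebraMap (algebraMap k K).injective 2
  have := Fintype.ofFinite k
  have hq (x : K) (hx : x ^ 2 + algebraMap k K p * x + algebraMap k K s = 0) :
      (x ^ Nat.card k) ^ 2 + algebraMap k K p * x ^ Nat.card k + algebraMap k K s = 0 := by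
    have h0 : Nat.card k ≠ 0 := Nat.card_pos.ne'
    have hfix (u : k) : algebraMap k K u ^ Nat.card k = algebraMap k K u := by
      rw [← map_pow, ← Fintype.card_eq_nat_card, FiniteField.pow_card]
    have := congrArg (· ^ Nat.card k) hx
    simp only [zero_pow h0] at this
    rw [hk, add_pow_char_pow, add_pow_char_pow, mul_pow, ← hk, hfix, hfix, ← pow_mul, mul_comm 2,
      pow_mul] at this
    exact this
  have h1 := hq r h
  have h2 := hq _ h1
  rw [show r ^ Nat.card k ^ 2 = (r ^ Nat.card k) ^ Nat.card k by rw [← pow_mul, sq]]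
  by_cases hr : r ^ Nat.card k = r
  · rw [hr, hr]
  have hsum : r ^ Nat.card k + r + algebraMap k K p = 0 := by
    refine (mul_eq_zero.mp ?_).resolve_left (sub_ne_zero.mpr hr)
    linear_combination h1 - h
  obtain h3 | h3 := eq_or_ne ((r ^ Nat.card k) ^ Nat.card k) (r ^ Nat.card k)
  · have hinj : Function.Injective (fun x : K => x ^ Nat.card k) := by
      rw [hk]
      exact iterateFrobenius_inj K 2 n
    exact absurd (hinj h3) hr
  · have hsum2 : (r ^ Nat.card k) ^ Nat.card k + r ^ Nat.card k + algebraMap k K p = 0 := by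
      refine (mul_eq_zero.mp ?_).resolve_left (sub_ne_zero.mpr h3)
      linear_combination h2 - h1
    linear_combination hsum2 - hsum

/-- If the product of the `X + rᵢ`, where the `rᵢ` are the conjugates of `r`, splits into quadratic
factors over `k`, then the third elementary symmetric function of the `rᵢ` vanishes. -/
lemma esymm_three_eq_zero_of_factorization {n : ℕ} (hk : Nat.card k = 2 ^ n) {r : K}
    {p s t u : k}
    (ha : algebraMap k K (p + t) =
      r + r ^ Nat.card k + r ^ Nat.card k ^ 2 + r ^ Nat.card k ^ 3)
    (hb : algebraMap k K (s + u + p * t) = r * r ^ Nat.card k + r * r ^ Nat.card k ^ 2 +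
      r * r ^ Nat.card k ^ 3 + r ^ Nat.card k * r ^ Nat.card k ^ 2 +
      r ^ Nat.card k * r ^ Nat.card k ^ 3 + r ^ Nat.card k ^ 2 * r ^ Nat.card k ^ 3)
    (hc : algebraMap k K (p * u + s * t) = r * r ^ Nat.card k * r ^ Nat.card k ^ 2 +
      r * r ^ Nat.card k * r ^ Nat.card k ^ 3 + r * r ^ Nat.card k ^ 2 * r ^ Nat.card k ^ 3 +
      r ^ Nat.card k * r ^ Nat.card k ^ 2 * r ^ Nat.card k ^ 3)
    (hd : algebraMap k K (s * u) = r * r ^ Nat.card k * r ^ Nat.card k ^ 2 * r ^ Nat.card k ^ 3) :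
    p * u + s * t = 0 := by
  have : CharP K 2 := charP_of_injective_algebraMap (algebraMap k K).injective 2
  have h2 : (2 : K) = 0 := CharTwo.two_eq_zero
  have hprod : (r ^ 2 + algebraMap k K p * r + algebraMap k K s) *
      (r ^ 2 + algebraMap k K t * r + algebraMap k K u) = 0 := by
    simp only [map_add, map_mul] at ha hb hc hd
    generalize r ^ Nat.card k = r₁ at *
    generalize r ^ Nat.card k ^ 2 = r₂ at *
    generalize r ^ Nat.card k ^ 3 = r₃ at *
    linear_combination r ^ 3 * ha + r ^ 2 * hb + r * hc + hd + (r ^ 4 + r ^ 3 * (r₁ + r₂ + r₃)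
      + r ^ 2 * (r₁ * r₂ + r₁ * r₃ + r₂ * r₃) + r * r₁ * r₂ * r₃) * h2
  have hr : r ^ Nat.card k ^ 2 = r := by
    rcases mul_eq_zero.mp hprod with h | h <;> exact pow_card_sq_eq_of_quadratic hk h
  have hr3 : r ^ Nat.card k ^ 3 = r ^ Nat.card k := by rw [pow_succ, pow_mul, hr]
  apply (algebraMap k K).injective
  rw [hc, hr3, hr, map_zero]
  linear_combination (r ^ 2 * r ^ Nat.card k + r * (r ^ Nat.card k) ^ 2) * h2

end Norm

theorem stmt11 (n : ℕ) (hn : Even n) (h4 : 4 ≤ n)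
    (F : Type*) [Field F] [Fintype F] (hF : Fintype.card F = (2 ^ n) ^ 4)
    (a : F) (ha : a ≠ 0) :
    ¬ Function.Bijective
      (fun x : F =>
        x ^ (2 * (2 ^ n) ^ 3 + 2 * (2 ^ n) ^ 2 + 2 * 2 ^ n + 3) + a * x) := by
  intro hbij
  have hn0 : n ≠ 0 := by omega
  have : CharP F 2 := by
    obtain ⟨p, hp⟩ := CharP.exists F
    obtain ⟨m, hprime, hm⟩ := FiniteField.card F p
    have hdvd : p ∣ (2 ^ n) ^ 4 := hF ▸ hm ▸ dvd_pow_self p m.ne_zero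
    have hp2 : p = 2 := (Nat.prime_dvd_prime_iff_eq hprime Nat.prime_two).mp
      (hprime.dvd_of_dvd_pow (hprime.dvd_of_dvd_pow hdvd))
    exact hp2 ▸ hp
  let := ZMod.algebra F 2
  have hrank : Module.finrank (ZMod 2) F = n * 4 := by
    apply Nat.pow_right_injective (le_refl 2)
    change 2 ^ _ = 2 ^ _
    rw [FiniteField.pow_finrank_eq_card, hF, pow_mul]
  obtain ⟨φ⟩ := FiniteField.nonempty_algHom_of_finrank_dvd (F := ZMod 2) (K := GaloisField 2 n)
    (L := F) (by rw [GaloisField.finrank 2 hn0, hrank]; exact dvd_mul_right n 4)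
  let := φ.toRingHom.toAlgebra
  have hcard : Nat.card (GaloisField 2 n) = 2 ^ n := GaloisField.card 2 n hn0
  have hfin : Module.finrank (GaloisField 2 n) F = 4 := by
    have h := Module.natCard_eq_pow_finrank (K := GaloisField 2 n) (V := F)
    rw [← Fintype.card_eq_nat_card, hF, hcard] at h
    exact (Nat.pow_right_injective (Nat.le_self_pow hn0 2) h).symm
  obtain ⟨c₃, c₂, c₁, c₀, h₃, h₂, h₁, h₀⟩ := exists_algebraMap_eq_esymm hcard hfin a
  have := Fintype.ofFinite (GaloisField 2 n)
  have hinj : Function.Injective (oddNonic c₃ c₂ c₁ c₀) := by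
    refine Finite.injective_iff_surjective.mpr fun y => ?_
    obtain ⟨z, rfl⟩ := FiniteField.norm_surjective (GaloisField 2 n) F y
    obtain ⟨x, rfl⟩ := hbij.2 z
    refine ⟨Algebra.norm _ x, ?_⟩
    rw [← norm_mul_sq_add hcard hfin h₃ h₂ h₁ h₀ x, algebraMap_norm_of_finrank_eq_four hfin, hcard]
    congr 1
    ring
  obtain ⟨m, rfl⟩ := hn
  have hcard4 : Fintype.card (GaloisField 2 (m + m)) = 4 ^ m := by
    rw [Fintype.card_eq_nat_card, hcard, ← two_mul, pow_mul]
    norm_num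
  obtain hm | hm : m = 2 ∨ 3 ≤ m := by omega
  · subst hm
    obtain ⟨hc, p, s, t, u, rfl, rfl, rfl, rfl⟩ :=
      exists_factorization_of_card_eq_sixteen (by rw [hcard4]; norm_num) hinj
    exact hc (esymm_three_eq_zero_of_factorization hcard h₃ h₂ h₁ h₀)
  · exact not_injective_oddNonic hm hcard4 _ _ _ _ hinj
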